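/- Fix an integer k ≥ 2 and let n range over multiples of k. Let y_n ∈ Θ_A be the true color assignment and U_n = P(y_n) + σ_n W_c the observation, where W_c is a standard GUE matrix. If there is a constant δ > 0 such that σ_n² < (1−δ)·n·(1−cos(2π/k))/(2 log n) for all n, then the probability that every minimizer of ‖U_n − P(x)‖_F² over x ∈ Θ_A is equivalent to y_n tends to 1 as n → ∞. -/

import Mathlib

open MeasureTheory ProbabilityTheory Filter Finset

/-- Law of the independent real coordinates parametrizing a standard GUE matrix:
the diagonal entries (at `(i,i)`) are `N(0,1)`, and for `i ≠ j` the coordinate at `(i,j)`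
is `N(0,1/2)`; for `i < j` the coordinates at `(i,j)` and `(j,i)` serve as the real and
imaginary parts of the `(i,j)` entry of the GUE matrix. -/
noncomputable def gueParamMeasure (n : ℕ) : Measure (Fin n → Fin n → ℝ) :=
  Measure.pi fun i : Fin n => Measure.pi fun j : Fin n =>
    gaussianReal 0 (if i = j then 1 else 1 / 2)

/-- The Hermitian (GUE) matrix built from the real parameters `A`. -/
noncomputable def gueOfParam {n : ℕ} (A : Fin n → Fin n → ℝ) : Fin n → Fin n → ℂ :=
  fun i j =>
    if i = j then (A i i : ℂ)
    else if (i : ℕ) < (j : ℕ) then (A i j : ℂ) + (A j i : ℂ) * Complex.I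
    else (A j i : ℂ) - (A i j : ℂ) * Complex.I

/-- The `m`-th of the `k`-th roots of unity, `e^{2πi m/k}`. -/
noncomputable def rootUnity (k : ℕ) (m : Fin k) : ℂ :=
  Complex.exp (2 * (Real.pi : ℂ) * Complex.I * ((m : ℕ) : ℂ) / (k : ℂ))

/-- The matrix `P(x)` with entries `P(x)_{ab} = x(a) conj(x(b))`, where the color indices are
interpreted as `k`-th roots of unity. -/
noncomputable def Pmat {n : ℕ} (k : ℕ) (x : Fin n → Fin k) : Fin n → Fin n → ℂ :=
  fun a b => rootUnity k (x a) * (starRingEnd ℂ) (rootUnity k (x b))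

/-- The squared Frobenius norm of a complex `n × n` matrix. -/
noncomputable def frobSqC {n : ℕ} (A : Fin n → Fin n → ℂ) : ℝ :=
  ∑ i, ∑ j, Complex.normSq (A i j)

/-- The number of vertices to which `x` assigns color `i`. -/
def colorCard {n k : ℕ} (x : Fin n → Fin k) (i : Fin k) : ℕ :=
  (Finset.univ.filter fun v => x v = i).card

instance isProbabilityMeasure_gueParamMeasure (n : ℕ) :
    IsProbabilityMeasure (gueParamMeasure n) := by
  unfold gueParamMeasure
  infer_instance

/-- Chernoff bound for linear forms in the coordinates of a standard GUE matrix. -/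
lemma gueParamMeasure_real_le_sum_le (n : ℕ) (c : Fin n → Fin n → ℝ) (T : ℝ) :
    (gueParamMeasure n).real {A | T ≤ ∑ i, ∑ j, c i j * A i j} ≤
      Real.exp ((∑ i, ∑ j, (if i = j then (1 : ℝ) else 1 / 2) * c i j ^ 2 / 2) - T) := by
  have hexp : ∀ A : Fin n → Fin n → ℝ, Real.exp (1 * ∑ i, ∑ j, c i j * A i j) =
      ∏ i, ∏ j, Real.exp (c i j * A i j) := by
    intro A
    simp only [one_mul, Real.exp_sum]
  have hrow : ∀ i : Fin n, Integrable (fun a : Fin n → ℝ => ∏ j, Real.exp (c i j * a j))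
      (Measure.pi fun j : Fin n => gaussianReal 0 (if i = j then 1 else 1 / 2)) := fun i =>
    Integrable.fintype_prod_dep (f := fun j (x : ℝ) => Real.exp (c i j * x))
      fun j => integrable_exp_mul_gaussianReal _
  have hintegrable : Integrable (fun A : Fin n → Fin n → ℝ => Real.exp (1 * ∑ i, ∑ j, c i j * A i j))
      (gueParamMeasure n) := by
    simp only [hexp]
    exact Integrable.fintype_prod_dep
      (f := fun i (a : Fin n → ℝ) => ∏ j, Real.exp (c i j * a j)) hrow
  have hmgf : mgf (fun A : Fin n → Fin n → ℝ => ∑ i, ∑ j, c i j * A i j) (gueParamMeasure n) 1 =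
      Real.exp (∑ i, ∑ j, (if i = j then (1 : ℝ) else 1 / 2) * c i j ^ 2 / 2) := by
    simp only [mgf, hexp, Real.exp_sum]
    unfold gueParamMeasure
    rw [integral_fintype_prod_eq_prod (f := fun i (a : Fin n → ℝ) => ∏ j, Real.exp (c i j * a j))]
    refine Finset.prod_congr rfl fun i _ => ?_
    rw [integral_fintype_prod_eq_prod (f := fun j (x : ℝ) => Real.exp (c i j * x))]
    refine Finset.prod_congr rfl fun j _ => ?_
    have h := congrFun (mgf_fun_id_gaussianReal (μ := 0) (v := if i = j then 1 else 1 / 2)) (c i j)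
    simp only [mgf] at h
    rw [h]
    split_ifs <;> simp
  refine (measure_ge_le_exp_mul_mgf T zero_le_one hintegrable).trans_eq ?_
  rw [hmgf, ← Real.exp_add]
  ring_nf

/-- Subgaussian bound on the probability that a Hermitian perturbation with zero diagonal does
not increase the squared Frobenius norm of a scaled GUE matrix. -/
lemma gueParamMeasure_real_frobSqC_add_le (n : ℕ) (H : Fin n → Fin n → ℂ)
    (hH : ∀ i j, H j i = (starRingEnd ℂ) (H i j)) (hdiag : ∀ i, H i i = 0)
    {σ s : ℝ} (hs : 0 < s) (hσ : σ ^ 2 ≤ s) :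
    (gueParamMeasure n).real {A | frobSqC (fun a b => H a b + (σ : ℂ) * gueOfParam A a b) ≤
        frobSqC (fun a b => (σ : ℂ) * gueOfParam A a b)} ≤
      Real.exp (-(frobSqC H / (8 * s))) := by
  set b : Fin n → Fin n → ℝ := fun i j => if (i : ℕ) < (j : ℕ) then (H i j).re else (H j i).im
    with hb
  have hbdiag : ∀ i, b i i = 0 := by simp [hb, hdiag]
  have hcross : ∀ (A : Fin n → Fin n → ℝ) i j,
      (H i j).re * (gueOfParam A i j).re + (H i j).im * (gueOfParam A i j).im =
        b i j * A i j + b j i * A j i := by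
    intro A i j
    rcases lt_trichotomy i j with h | h | h
    · simp [hb, gueOfParam, h.ne, h, h.not_gt]
    · subst h
      simp [hb, hdiag]
    · simp [hb, gueOfParam, h.ne', h, h.not_gt, hH j i]
      ring
  have hsq : ∀ i j, Complex.normSq (H i j) = b i j ^ 2 + b j i ^ 2 := by
    intro i j
    rcases lt_trichotomy i j with h | h | h
    · simp [hb, h, h.not_gt, Complex.normSq_apply]
      ring
    · subst h
      simp [hb, hdiag]
    · simp [hb, h, h.not_gt, hH j i, Complex.normSq_apply]
      ring
  have hfrob : frobSqC H = 2 * ∑ i, ∑ j, b i j ^ 2 := by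
    simp only [frobSqC, hsq, Finset.sum_add_distrib]
    rw [Finset.sum_comm (f := fun i j => b j i ^ 2)]
    ring
  have hexpand : ∀ A : Fin n → Fin n → ℝ,
      frobSqC (fun a b => H a b + (σ : ℂ) * gueOfParam A a b) =
        frobSqC H + frobSqC (fun a b => (σ : ℂ) * gueOfParam A a b) +
          4 * σ * ∑ i, ∑ j, b i j * A i j := by
    intro A
    have h1 : ∀ i j, Complex.normSq (H i j + (σ : ℂ) * gueOfParam A i j) =
        Complex.normSq (H i j) + Complex.normSq ((σ : ℂ) * gueOfParam A i j) +
          2 * σ * (b i j * A i j + b j i * A j i) := by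
      intro i j
      rw [← hcross A i j]
      simp [Complex.normSq_apply]
      ring
    simp only [frobSqC, h1, Finset.sum_add_distrib, ← Finset.mul_sum]
    rw [Finset.sum_comm (f := fun i j => b j i * A j i)]
    ring
  have hsub : {A | frobSqC (fun a b => H a b + (σ : ℂ) * gueOfParam A a b) ≤
        frobSqC (fun a b => (σ : ℂ) * gueOfParam A a b)} ⊆
      {A | frobSqC H / (4 * s) ≤ ∑ i, ∑ j, (-(σ / s) * b i j) * A i j} := by
    intro A hA
    simp only [Set.mem_ofPred_eq, hexpand A] at hA ⊢
    simp only [mul_assoc, ← Finset.mul_sum]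
    rw [div_le_iff₀ (by positivity)]
    calc frobSqC H ≤ -(4 * σ * ∑ i, ∑ j, b i j * A i j) := by linarith
      _ = _ := by field_simp
  refine (measureReal_mono hsub).trans ((gueParamMeasure_real_le_sum_le n _ _).trans ?_)
  apply Real.exp_le_exp.mpr
  have hvar : ∑ i, ∑ j, (if i = j then (1 : ℝ) else 1 / 2) * (-(σ / s) * b i j) ^ 2 / 2 =
      σ ^ 2 / (8 * s ^ 2) * frobSqC H := by
    rw [hfrob, Finset.mul_sum, Finset.mul_sum]
    refine Finset.sum_congr rfl fun i _ => ?_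
    rw [Finset.mul_sum, Finset.mul_sum]
    refine Finset.sum_congr rfl fun j _ => ?_
    by_cases hij : i = j
    · subst hij
      simp [hbdiag]
    · simp only [if_neg hij]
      field_simp
      ring
  have hnn : 0 ≤ frobSqC H := by
    unfold frobSqC
    exact Finset.sum_nonneg fun i _ => Finset.sum_nonneg fun j _ => Complex.normSq_nonneg _
  have hle : σ ^ 2 / (8 * s ^ 2) * frobSqC H ≤ frobSqC H / (8 * s) := by
    calc σ ^ 2 / (8 * s ^ 2) * frobSqC H ≤ s / (8 * s ^ 2) * frobSqC H := by gcongr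
      _ = _ := by field_simp
  have hsplit : frobSqC H / (4 * s) = 2 * (frobSqC H / (8 * s)) := by
    field_simp
    ring
  rw [hvar, hsplit]
  linarith

lemma rootUnity_mul_conj_re (k : ℕ) (a b : Fin k) :
    (rootUnity k a * (starRingEnd ℂ) (rootUnity k b)).re =
      Real.cos (2 * Real.pi * ((a : ℕ) - (b : ℕ) : ℝ) / k) := by
  have h : rootUnity k a * (starRingEnd ℂ) (rootUnity k b) =
      Complex.exp ((2 * Real.pi * ((a : ℕ) - (b : ℕ) : ℝ) / k : ℝ) * Complex.I) := by
    unfold rootUnity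
    rw [← Complex.exp_conj, ← Complex.exp_add]
    congr 1
    simp [Complex.conj_ofNat]
    ring
  rw [h, Complex.exp_ofReal_mul_I_re]

lemma rootUnity_mul_conj_re_le (k : ℕ) {a b : Fin k} (hab : a ≠ b) :
    (rootUnity k a * (starRingEnd ℂ) (rootUnity k b)).re ≤ Real.cos (2 * Real.pi / k) := by
  rw [rootUnity_mul_conj_re]
  wlog h : b < a generalizing a b
  · have := this hab.symm (lt_of_le_of_ne (not_lt.mp h) hab)
    rwa [← Real.cos_neg, ← neg_div, ← mul_neg, neg_sub] at this
  have hk : (0 : ℝ) < k := by exact_mod_cast a.pos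
  have h1 : ((b : ℕ) : ℝ) + 1 ≤ ((a : ℕ) : ℝ) := by exact_mod_cast h
  have h2 : ((a : ℕ) : ℝ) + 1 ≤ k := by exact_mod_cast a.isLt
  have h3 : (0 : ℝ) ≤ ((b : ℕ) : ℝ) := Nat.cast_nonneg _
  have hpi := Real.pi_pos
  have hlow : 2 * Real.pi / k ≤ 2 * Real.pi * ((a : ℕ) - (b : ℕ) : ℝ) / k := by
    refine div_le_div_of_nonneg_right ?_ hk.le
    nlinarith
  have hhigh : 2 * Real.pi / k ≤ 2 * Real.pi - 2 * Real.pi * ((a : ℕ) - (b : ℕ) : ℝ) / k := by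
    rw [le_sub_iff_add_le, ← add_div, div_le_iff₀ hk]
    nlinarith
  have hpos : 0 ≤ 2 * Real.pi / k := by positivity
  rcases le_total (2 * Real.pi * ((a : ℕ) - (b : ℕ) : ℝ) / k) Real.pi with h | h
  · exact Real.cos_le_cos_of_nonneg_of_le_pi hpos h hlow
  · rw [← Real.cos_two_pi_sub]
    exact Real.cos_le_cos_of_nonneg_of_le_pi hpos (by linarith) hhigh

lemma normSq_rootUnity (k : ℕ) (a : Fin k) : Complex.normSq (rootUnity k a) = 1 := by
  have h := rootUnity_mul_conj_re k a a
  rw [Complex.mul_conj] at h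
  simpa using h

lemma rootUnity_add (k : ℕ) [NeZero k] (a b : Fin k) :
    rootUnity k (a + b) = rootUnity k a * rootUnity k b := by
  have hpow : ∀ m : ℕ, Complex.exp (2 * (Real.pi : ℂ) * Complex.I * (m : ℂ) / (k : ℂ)) =
      Complex.exp (2 * (Real.pi : ℂ) * Complex.I / k) ^ m := by
    intro m
    rw [← Complex.exp_nat_mul]
    congr 1
    ring
  have hprim := (Complex.isPrimitiveRoot_exp k (NeZero.ne k)).pow_eq_one
  unfold rootUnity
  rw [hpow, hpow, hpow, ← pow_add, Fin.val_add]
  exact (pow_eq_pow_mod _ hprim).symm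

lemma normSq_sub_Pmat_ge {n : ℕ} (k : ℕ) [NeZero k] (x y : Fin n → Fin k) (i j : Fin n)
    (h : y i - x i ≠ y j - x j) :
    2 * (1 - Real.cos (2 * Real.pi / k)) ≤ Complex.normSq (Pmat k y i j - Pmat k x i j) := by
  have hy : ∀ l, rootUnity k (y l) = rootUnity k (x l) * rootUnity k (y l - x l) := by
    intro l
    rw [← rootUnity_add, add_sub_cancel]
  have hfac : Pmat k y i j - Pmat k x i j = Pmat k x i j *
      (rootUnity k (y i - x i) * (starRingEnd ℂ) (rootUnity k (y j - x j)) - 1) := by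
    unfold Pmat
    rw [hy i, hy j, map_mul]
    ring
  have hre := rootUnity_mul_conj_re_le k h
  have hn : Complex.normSq (rootUnity k (y i - x i) *
      (starRingEnd ℂ) (rootUnity k (y j - x j))) = 1 := by
    simp [normSq_rootUnity]
  rw [hfac, Complex.normSq_mul, Complex.normSq_sub, hn]
  simp only [Pmat, Complex.normSq_mul, Complex.normSq_conj, normSq_rootUnity, map_one, mul_one]
  linarith

/-- If `c` is a most frequent value of `d` and `t` indices have a value other than `c`, then the
number of ordered pairs with distinct values is at least `n * t` and at least `2 * t * (n - t)`. -/
lemma exists_card_ne_pairs_ge {n k : ℕ} [NeZero k] (d : Fin n → Fin k) :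
    ∃ c : Fin k,
      (n : ℝ) * #{l | d l ≠ c} ≤ ∑ i, (#{j | d i ≠ d j} : ℝ) ∧
      2 * (#{l | d l ≠ c} : ℝ) * (n - #{l | d l ≠ c}) ≤ ∑ i, (#{j | d i ≠ d j} : ℝ) := by
  obtain ⟨c, hc⟩ := Finite.exists_max fun c : Fin k => #{l | d l = c}
  have hsplit : ∀ c : Fin k, (#{l | d l = c} : ℝ) + #{l | d l ≠ c} = n := by
    intro c
    have h := Finset.card_filter_add_card_filter_not (s := (univ : Finset (Fin n)))
      (fun l => d l = c)
    rw [Finset.card_univ, Fintype.card_fin] at h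
    exact_mod_cast h
  have hcomm : ∀ i, (#{j | d i ≠ d j} : ℝ) = #{j | d j ≠ d i} := fun i => by
    simp only [ne_comm]
  refine ⟨c, ?_, ?_⟩
  · have h : ∀ i ∈ (univ : Finset (Fin n)), (#{l | d l ≠ c} : ℝ) ≤ #{j | d i ≠ d j} := by
      intro i _
      have h1 : (#{l | d l = d i} : ℝ) ≤ #{l | d l = c} := by exact_mod_cast hc (d i)
      rw [hcomm]
      linarith [hsplit c, hsplit (d i)]
    simpa using Finset.card_nsmul_le_sum _ _ _ h
  · have h : ∀ i ∈ (univ : Finset (Fin n)),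
        (if d i = c then (#{l | d l ≠ c} : ℝ) else #{l | d l = c}) ≤ #{j | d i ≠ d j} := by
      intro i _
      rw [hcomm]
      split_ifs with hi
      · rw [hi]
      · have hsub : #{l | d l = c} ≤ #{j | d j ≠ d i} := by
          refine Finset.card_le_card fun l hl => ?_
          simp only [Finset.mem_filter, Finset.mem_univ, true_and] at hl ⊢
          rw [hl]
          exact fun h => hi h.symm
        exact_mod_cast hsub
    refine le_trans (le_of_eq ?_) (Finset.sum_le_sum h)
    rw [Finset.sum_ite, Finset.sum_const, Finset.sum_const, nsmul_eq_mul, nsmul_eq_mul]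
    have := hsplit c
    rw [show (n : ℝ) - #{l | d l ≠ c} = #{l | d l = c} by linarith]
    simp only [ne_eq]
    ring

lemma sum_pow_card_sub_ne {n k : ℕ} [NeZero k] (y : Fin n → Fin k) (c : Fin k) (q : ℝ) :
    ∑ x : Fin n → Fin k, q ^ #{l | y l - x l ≠ c} = (1 + (k - 1) * q) ^ n := by
  have hpow : ∀ x : Fin n → Fin k,
      q ^ #{l | y l - x l ≠ c} = ∏ l, if y l - x l ≠ c then q else 1 := by
    intro x
    rw [Finset.prod_ite]
    simp
  have hcol : ∀ l, ∑ b : Fin k, (if y l - b ≠ c then q else 1) = 1 + (k - 1) * q := by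
    intro l
    have h : ∀ b : Fin k, (if y l - b ≠ c then q else 1) = q + if b = y l - c then 1 - q else 0 := by
      intro b
      have hiff : y l - b = c ↔ b = y l - c := by
        rw [sub_eq_iff_eq_add, eq_sub_iff_add_eq, add_comm c, eq_comm]
      by_cases hb : b = y l - c
      · simp [hb]
      · rw [if_pos (mt hiff.mp hb), if_neg hb, add_zero]
    simp only [h, Finset.sum_add_distrib, Finset.sum_const, Finset.card_univ, Fintype.card_fin,
      nsmul_eq_mul, Finset.sum_ite_eq', Finset.mem_univ, if_true]
    ring
  simp only [hpow]
  rw [← Fintype.prod_sum (fun l b => if y l - b ≠ c then q else 1)]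
  simp only [hcol, Finset.prod_const, Finset.card_univ, Fintype.card_fin]

lemma sum_pow_card_sub_ne_le {n k : ℕ} [NeZero k] (y : Fin n → Fin k) (c : Fin k) {q : ℝ}
    (hq : 0 ≤ q) (S : Finset (Fin n → Fin k)) (hS : ∀ x ∈ S, ∃ l, y l - x l ≠ c) :
    ∑ x ∈ S, q ^ #{l | y l - x l ≠ c} ≤ (1 + (k - 1) * q) ^ n - 1 := by
  have hmem : (fun l => y l - c) ∉ S := by
    intro h
    obtain ⟨l, hl⟩ := hS _ h
    simp at hl
  have hins : ∑ x ∈ insert (fun l => y l - c) S, q ^ #{l | y l - x l ≠ c} ≤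
      ∑ x : Fin n → Fin k, q ^ #{l | y l - x l ≠ c} :=
    Finset.sum_le_sum_of_subset_of_nonneg (Finset.subset_univ _) fun _ _ _ => pow_nonneg hq _
  rw [Finset.sum_insert hmem, sum_pow_card_sub_ne] at hins
  simp only [sub_sub_cancel, ne_eq, not_true_eq_false, Finset.filter_false, Finset.card_empty,
    pow_zero] at hins
  simp only [ne_eq]
  linarith

lemma exp_neg_pairs_le {n t : ℕ} {N δ L : ℝ} (hn : 0 < n) (hδ0 : 0 < δ) (hδ1 : δ < 1)
    (hL : 0 ≤ L) (h1 : (n : ℝ) * t ≤ N) (h2 : 2 * (t : ℝ) * (n - t) ≤ N) :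
    Real.exp (-(N * L / (2 * (1 - δ) * n))) ≤
      Real.exp (-((1 - δ / 2) / (1 - δ) * L)) ^ t + Real.exp (-(δ / (4 * (1 - δ)) * L * n)) := by
  have hn' : (0 : ℝ) < n := by exact_mod_cast hn
  have hδ' : 0 < 1 - δ := by linarith
  have ht : (0 : ℝ) ≤ t := Nat.cast_nonneg _
  rw [← Real.exp_nat_mul]
  rcases le_total (t : ℝ) (δ / 2 * n) with h | h
  · refine le_add_of_le_of_nonneg (Real.exp_le_exp.mpr ?_) (Real.exp_nonneg _)
    rw [mul_neg, neg_le_neg_iff, le_div_iff₀ (by positivity)]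
    have hN : 2 * (t : ℝ) * ((1 - δ / 2) * n) ≤ N := by nlinarith
    calc (t : ℝ) * ((1 - δ / 2) / (1 - δ) * L) * (2 * (1 - δ) * n)
        = 2 * (t : ℝ) * ((1 - δ / 2) * n) * L := by field_simp
      _ ≤ N * L := by gcongr
  · refine le_add_of_nonneg_of_le (by positivity) (Real.exp_le_exp.mpr ?_)
    rw [neg_le_neg_iff, le_div_iff₀ (by positivity)]
    have hN : δ / 2 * n * n ≤ N := by nlinarith
    calc δ / (4 * (1 - δ)) * L * n * (2 * (1 - δ) * n) = δ / 2 * n * n * L := by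
          field_simp
          ring
      _ ≤ N * L := by gcongr

lemma frobSqC_sub_Pmat_ge {n k : ℕ} [NeZero k] (x y : Fin n → Fin k) :
    2 * (1 - Real.cos (2 * Real.pi / k)) *
        ∑ i, (#{j | y i - x i ≠ y j - x j} : ℝ) ≤
      frobSqC (fun a b => Pmat k y a b - Pmat k x a b) := by
  unfold frobSqC
  rw [Finset.mul_sum]
  refine Finset.sum_le_sum fun i _ => ?_
  rw [← Finset.sum_filter_add_sum_filter_not univ fun j => y i - x i ≠ y j - x j]
  refine le_add_of_le_of_nonneg ?_ (Finset.sum_nonneg fun _ _ => Complex.normSq_nonneg _)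
  rw [mul_comm, ← nsmul_eq_mul]
  refine Finset.card_nsmul_le_sum _ _ _ fun j hj => ?_
  exact normSq_sub_Pmat_ge k x y i j (Finset.mem_filter.mp hj).2

/-- Union bound for the event that some coloring which is not a rotation of `y` fits the
observation at least as well as `y`. -/
lemma gueParamMeasure_real_iUnion_le {n k : ℕ} [NeZero k] (hk : 2 ≤ k) (hn : 2 ≤ n)
    (y : Fin n → Fin k) {σ δ : ℝ} (hδ0 : 0 < δ) (hδ1 : δ < 1)
    (hσ : σ ^ 2 ≤ (1 - δ) * n * (1 - Real.cos (2 * Real.pi / k)) / (2 * Real.log n)) :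
    (gueParamMeasure n).real (⋃ x ∈ ({x | ∀ c, ∃ l, y l - x l ≠ c} : Finset (Fin n → Fin k)),
      {A | frobSqC (fun a b => (Pmat k y a b - Pmat k x a b) + (σ : ℂ) * gueOfParam A a b) ≤
        frobSqC (fun a b => (σ : ℂ) * gueOfParam A a b)}) ≤
      k * ((1 + (k - 1) * Real.exp (-((1 - δ / 2) / (1 - δ) * Real.log n))) ^ n - 1) +
        k ^ n * Real.exp (-(δ / (4 * (1 - δ)) * Real.log n * n)) := by
  set q := Real.exp (-((1 - δ / 2) / (1 - δ) * Real.log n))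
  set r := Real.exp (-(δ / (4 * (1 - δ)) * Real.log n * n))
  set κ := 1 - Real.cos (2 * Real.pi / k) with hκ
  have hn' : (2 : ℝ) ≤ n := by exact_mod_cast hn
  have hk' : (2 : ℝ) ≤ k := by exact_mod_cast hk
  have hlog : 0 < Real.log n := Real.log_pos (by linarith)
  have hδ' : 0 < 1 - δ := by linarith
  have hκ0 : 0 < κ := by
    have hpi := Real.pi_pos
    have hlt : Real.cos (2 * Real.pi / k) < Real.cos 0 := by
      refine Real.cos_lt_cos_of_nonneg_of_le_pi le_rfl ?_ (by positivity)
      rw [div_le_iff₀ (by linarith)]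
      nlinarith
    rw [Real.cos_zero] at hlt
    linarith
  have hs : 0 < (1 - δ) * n * κ / (2 * Real.log n) := by positivity
  have halg : ∀ N L v : ℝ, L ≠ 0 → v ≠ 0 →
      N * L / (2 * (1 - δ) * v) * (8 * ((1 - δ) * v * κ / (2 * L))) = 2 * κ * N := by
    intro N L v hL hv
    field_simp
    ring
  have hterm : ∀ x : Fin n → Fin k, (gueParamMeasure n).real
      {A | frobSqC (fun a b => (Pmat k y a b - Pmat k x a b) + (σ : ℂ) * gueOfParam A a b) ≤
        frobSqC (fun a b => (σ : ℂ) * gueOfParam A a b)} ≤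
      ∑ c, q ^ #{l | y l - x l ≠ c} + r := by
    intro x
    have hP : ∀ (z : Fin n → Fin k) i, Pmat k z i i = 1 := fun z i => by
      simp [Pmat, Complex.mul_conj, normSq_rootUnity]
    refine (gueParamMeasure_real_frobSqC_add_le n (fun a b => Pmat k y a b - Pmat k x a b)
      (fun i j => ?_) (fun i => ?_) hs hσ).trans ?_
    · simp only [Pmat, map_sub, map_mul, Complex.conj_conj]
      ring
    · simp [hP]
    · obtain ⟨c, h1, h2⟩ := exists_card_ne_pairs_ge fun l => y l - x l
      have hfrob := frobSqC_sub_Pmat_ge x y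
      have hmain := exp_neg_pairs_le (by linarith) hδ0 hδ1 hlog.le h1 h2
      refine le_trans (Real.exp_le_exp.mpr ?_) (hmain.trans ?_)
      · rw [neg_le_neg_iff, le_div_iff₀ (by positivity)]
        exact (halg _ _ _ hlog.ne' (by linarith)).trans_le hfrob
      · gcongr
        exact Finset.single_le_sum (f := fun c => q ^ #{l | y l - x l ≠ c})
          (fun _ _ => pow_nonneg (Real.exp_nonneg _) _) (Finset.mem_univ c)
  refine (measureReal_biUnion_finset_le _ _).trans ?_
  refine (Finset.sum_le_sum fun x _ => hterm x).trans ?_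
  rw [Finset.sum_add_distrib, Finset.sum_comm]
  refine add_le_add ?_ ?_
  · have hcol : ∀ c ∈ (univ : Finset (Fin k)), _ := fun c _ =>
      sum_pow_card_sub_ne_le y c (q := q) (Real.exp_nonneg _) {x | ∀ c, ∃ l, y l - x l ≠ c}
        fun x hx => (Finset.mem_filter.mp hx).2 c
    refine (Finset.sum_le_sum hcol).trans_eq ?_
    rw [Finset.sum_const, Finset.card_univ, Fintype.card_fin, nsmul_eq_mul]
  · rw [Finset.sum_const, nsmul_eq_mul]
    refine mul_le_mul_of_nonneg_right ?_ (Real.exp_nonneg _)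
    have hcard := Finset.card_le_univ ({x | ∀ c, ∃ l, y l - x l ≠ c} : Finset (Fin n → Fin k))
    rw [Fintype.card_fun, Fintype.card_fin, Fintype.card_fin] at hcard
    exact_mod_cast hcard

lemma tendsto_union_bound (k : ℕ) (hk : 1 ≤ k) {δ : ℝ} (hδ0 : 0 < δ) (hδ1 : δ < 1) :
    Tendsto (fun n : ℕ =>
      (k : ℝ) * ((1 + (k - 1) * Real.exp (-((1 - δ / 2) / (1 - δ) * Real.log n))) ^ n - 1) +
        k ^ n * Real.exp (-(δ / (4 * (1 - δ)) * Real.log n * n))) atTop (nhds 0) := by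
  have hδ' : 0 < 1 - δ := by linarith
  have hk' : (1 : ℝ) ≤ k := by exact_mod_cast hk
  have hlog : Tendsto (fun n : ℕ => Real.log n) atTop atTop :=
    Real.tendsto_log_atTop.comp tendsto_natCast_atTop_atTop
  have hβ : 0 < δ / 2 / (1 - δ) := by positivity
  have hγ : 0 < δ / (4 * (1 - δ)) := by positivity
  have hfirst : Tendsto (fun n : ℕ => (k : ℝ) *
      (Real.exp ((k - 1) * Real.exp (-(δ / 2 / (1 - δ) * Real.log n))) - 1)) atTop (nhds 0) := by
    have h1 : Tendsto (fun n : ℕ => Real.exp (-(δ / 2 / (1 - δ) * Real.log n))) atTop (nhds 0) :=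
      Real.tendsto_exp_neg_atTop_nhds_zero.comp (hlog.const_mul_atTop hβ)
    have h2 := (Real.continuous_exp.tendsto _).comp (h1.const_mul ((k : ℝ) - 1))
    simpa using (h2.sub_const 1).const_mul (k : ℝ)
  have hsecond : Tendsto (fun n : ℕ => Real.exp
      (-((δ / (4 * (1 - δ)) * Real.log n + -Real.log k) * n))) atTop (nhds 0) :=
    Real.tendsto_exp_neg_atTop_nhds_zero.comp
      ((tendsto_atTop_add_const_right _ _ (hlog.const_mul_atTop hγ)).atTop_mul_atTop₀
        tendsto_natCast_atTop_atTop)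
  have hsum := hfirst.add hsecond
  rw [add_zero] at hsum
  refine tendsto_of_tendsto_of_tendsto_of_le_of_le' tendsto_const_nhds hsum ?_ ?_
  · refine Eventually.of_forall fun n => ?_
    have hbase : 1 ≤ 1 + ((k : ℝ) - 1) * Real.exp (-((1 - δ / 2) / (1 - δ) * Real.log n)) :=
      le_add_of_nonneg_right (mul_nonneg (by linarith) (Real.exp_nonneg _))
    have := one_le_pow₀ hbase (n := n)
    have h3 : 0 ≤ (1 + ((k : ℝ) - 1) * Real.exp (-((1 - δ / 2) / (1 - δ) * Real.log n))) ^ n - 1 := by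
      linarith
    positivity
  · filter_upwards [eventually_ge_atTop 1] with n hn
    have hn' : (0 : ℝ) < n := by exact_mod_cast hn
    refine add_le_add ?_ (le_of_eq ?_)
    · have hexp : (n : ℝ) * Real.exp (-((1 - δ / 2) / (1 - δ) * Real.log n)) =
          Real.exp (-(δ / 2 / (1 - δ) * Real.log n)) := by
        conv_lhs => enter [1]; rw [← Real.exp_log hn']
        rw [← Real.exp_add]
        congr 1
        field_simp
        ring
      have hpow : (1 + ((k : ℝ) - 1) * Real.exp (-((1 - δ / 2) / (1 - δ) * Real.log n))) ^ n ≤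
          Real.exp ((k - 1) * Real.exp (-(δ / 2 / (1 - δ) * Real.log n))) := by
        rw [← hexp, mul_left_comm, Real.exp_nat_mul, add_comm]
        refine pow_le_pow_left₀ ?_ (Real.add_one_le_exp _) n
        have := mul_nonneg (sub_nonneg.mpr hk')
          (Real.exp_nonneg (-((1 - δ / 2) / (1 - δ) * Real.log n)))
        linarith
      gcongr
    · have hkn : (k : ℝ) ^ n = Real.exp (n * Real.log k) := by
        rw [Real.exp_nat_mul, Real.exp_log (by linarith)]
      rw [hkn, ← Real.exp_add]
      congr 1
      ring

theorem gue_mle_subcritical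
    (k : ℕ) (hk : 2 ≤ k)
    (y : (m : ℕ) → Fin (k * m) → Fin k)
    (hy : ∀ m : ℕ, ∀ i : Fin k, colorCard (y m) i = m)
    (σ : ℕ → ℝ) (δ : ℝ) (hδ : 0 < δ)
    (hσ : ∀ m : ℕ, 1 ≤ m →
      σ m ^ 2 < (1 - δ) * (k * m : ℕ) * (1 - Real.cos (2 * Real.pi / k)) /
        (2 * Real.log (k * m : ℕ))) :
    Tendsto (fun m : ℕ => gueParamMeasure (k * m)
      {A | ∀ x : Fin (k * m) → Fin k, (∀ i, colorCard x i = m) →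
        (∀ z : Fin (k * m) → Fin k, (∀ i, colorCard z i = m) →
          frobSqC (fun a b => (Pmat k (y m) a b + (σ m : ℂ) * gueOfParam A a b) - Pmat k x a b) ≤
          frobSqC (fun a b => (Pmat k (y m) a b + (σ m : ℂ) * gueOfParam A a b) - Pmat k z a b)) →
        ∃ α : ℝ, ∀ l : Fin (k * m),
          Complex.exp ((α : ℂ) * Complex.I) * rootUnity k (x l) = rootUnity k (y m l)})
      atTop (nhds 1) := by
  have : NeZero k := ⟨by omega⟩
  have hcos : 0 ≤ 1 - Real.cos (2 * Real.pi / k) := by linarith [Real.cos_le_one (2 * Real.pi / k)]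
  have hδ1 : δ < 1 := by
    by_contra! h
    have h1 := hσ 1 le_rfl
    have hlog : 0 ≤ Real.log (k * 1 : ℕ) := Real.log_natCast_nonneg _
    have h2 : (1 - δ) * (k * 1 : ℕ) * (1 - Real.cos (2 * Real.pi / k)) /
        (2 * Real.log (k * 1 : ℕ)) ≤ 0 := by
      refine div_nonpos_of_nonpos_of_nonneg (mul_nonpos_of_nonpos_of_nonneg ?_ hcos) (by positivity)
      exact mul_nonpos_of_nonpos_of_nonneg (by linarith) (Nat.cast_nonneg _)
    linarith [sq_nonneg (σ 1)]
  have hsize : Tendsto (fun m : ℕ => k * m) atTop atTop :=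
    tendsto_id.const_mul_atTop' (by omega)
  have hbound := ENNReal.Tendsto.sub (tendsto_const_nhds (x := (1 : ENNReal)))
    (ENNReal.tendsto_ofReal ((tendsto_union_bound k (by omega) hδ hδ1).comp hsize))
    (Or.inl ENNReal.one_ne_top)
  rw [ENNReal.ofReal_zero, tsub_zero] at hbound
  refine tendsto_of_tendsto_of_tendsto_of_le_of_le' hbound tendsto_const_nhds ?_
    (Eventually.of_forall fun m => prob_le_one)
  filter_upwards [eventually_ge_atTop 1] with m hm
  have hn : 2 ≤ k * m := hk.trans (Nat.le_mul_of_pos_right k hm)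
  have hunion := gueParamMeasure_real_iUnion_le hk hn (y m) hδ hδ1 (hσ m hm).le
  refine tsub_le_iff_right.mpr (le_trans ?_ (add_le_add_right
    ((ENNReal.le_ofReal_iff_toReal_le (measure_ne_top _ _)
      (measureReal_nonneg.trans hunion)).mpr hunion) _))
  refine le_trans (le_of_eq measure_univ.symm) (le_trans (measure_mono ?_) (measure_union_le _ _))
  intro A _
  by_contra hA
  simp only [Set.mem_union, not_or, Set.mem_ofPred_eq, Set.mem_iUnion, not_exists] at hA
  obtain ⟨hbad, hgood⟩ := hA
  refine hbad fun x hx hmin => ?_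
  by_cases hrot : ∀ c, ∃ l, y m l - x l ≠ c
  · refine absurd ?_ (hgood x (by simpa using hrot))
    have h := hmin (y m) (hy m)
    simp only [add_sub_cancel_left, add_sub_right_comm] at h
    simpa using h
  · push Not at hrot
    obtain ⟨c, hc⟩ := hrot
    refine ⟨2 * Real.pi * (c : ℕ) / k, fun l => ?_⟩
    rw [← sub_add_cancel (y m l) (x l), hc l, rootUnity_add]
    congr 1
    unfold rootUnity
    congr 1
    push_cast
    ring
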